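/- For all sufficiently large K = 2^k, the following holds for every 1 ≤ j ≤ m−2 and every path P ∈ SL_{j+1}: there exist a real ℓ ∈ [K^j, (1 + 1/K)K^j], a positive integer d, and pairwise disjoint subpaths P^{(1)}, …, P^{(d)} ∈ SL_j of P such that (a) d ≥ K; (b) ℓ ≥ ‖P‖/d, and moreover ℓ ≥ (1 + 1/K²)·‖P‖/d if P is untame; (c) every box in BD_{K^j} is visited by at most 12 of the subpaths P^{(i)}; (d) ‖P^{(i)}‖ = ℓ and P^{(i)} ⊆ B(x_{P^{(i)}}, ℓ) for each i. -/

import Mathlib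

open MeasureTheory ProbabilityTheory Real Set Filter

/-- The lattice ℤ². -/
abbrev Z2 := ℤ × ℤ

/-- Nearest-neighbor adjacency on ℤ². -/
def Adj (x y : Z2) : Prop := |x.1 - y.1| + |x.2 - y.2| = 1

/-- The `L^∞` distance on ℤ². -/
def linf (x y : Z2) : ℤ := max |x.1 - y.1| |x.2 - y.2|

/-- The Euclidean distance on ℤ². -/
noncomputable def eZ (x y : Z2) : ℝ :=
  Real.sqrt (((x.1 - y.1 : ℤ) : ℝ) ^ 2 + ((x.2 - y.2 : ℤ) : ℝ) ^ 2)

/-- A lattice path viewed as a continuous curve in ℝ², parametrized at unit speed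
along the unit edges of ℤ², allowed to start and end at interior points of edges.
`v n` is the lattice vertex occupied at integer time `n`; the curve is defined on
the time interval `[a, b]`, and consecutive vertices are nearest neighbors. -/
structure GridPath where
  a : ℝ
  b : ℝ
  hab : a ≤ b
  v : ℤ → Z2
  adj : ∀ n : ℤ, a < (n : ℝ) + 1 → (n : ℝ) < b → Adj (v n) (v (n + 1))

/-- The point of the curve at time `t` (affine interpolation along edges). -/
noncomputable def GridPath.pt (P : GridPath) (t : ℝ) : ℝ × ℝ :=
  (((P.v ⌊t⌋).1 : ℝ) + (t - ⌊t⌋) * (((P.v (⌊t⌋ + 1)).1 : ℝ) - ((P.v ⌊t⌋).1 : ℝ)),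
   ((P.v ⌊t⌋).2 : ℝ) + (t - ⌊t⌋) * (((P.v (⌊t⌋ + 1)).2 : ℝ) - ((P.v ⌊t⌋).2 : ℝ)))

/-- The starting point `x_P` of the path. -/
noncomputable def GridPath.start (P : GridPath) : ℝ × ℝ := P.pt P.a

/-- The ending point `y_P` of the path. -/
noncomputable def GridPath.fin (P : GridPath) : ℝ × ℝ := P.pt P.b

/-- The image (trace) of the path in ℝ². -/
noncomputable def GridPath.image (P : GridPath) : Set (ℝ × ℝ) := P.pt '' Set.Icc P.a P.b

/-- Euclidean distance on ℝ². -/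
noncomputable def e2 (p q : ℝ × ℝ) : ℝ := Real.sqrt ((p.1 - q.1) ^ 2 + (p.2 - q.2) ^ 2)

/-- `‖P‖`, the Euclidean distance between the endpoints of `P`. -/
noncomputable def GridPath.norm (P : GridPath) : ℝ := e2 P.start P.fin

/-- The closed Euclidean ball `B(c, r)` in ℝ². -/
def cball (c : ℝ × ℝ) (r : ℝ) : Set (ℝ × ℝ) := {p | e2 c p ≤ r}

/-- A lattice point of ℤ² as a point of ℝ². -/
def castZ (z : Z2) : ℝ × ℝ := ((z.1 : ℝ), (z.2 : ℝ))

/-- The set of lattice points visited by the path. -/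
noncomputable def GridPath.lattice (P : GridPath) : Set Z2 := {z | castZ z ∈ P.image}

/-- `Q` is a subpath of `P`. -/
def SubPath (Q P : GridPath) : Prop :=
  P.a ≤ Q.a ∧ Q.b ≤ P.b ∧ ∀ t ∈ Set.Icc Q.a Q.b, Q.pt t = P.pt t

/-- Two paths are disjoint if, after removing their endpoints, their traces are
disjoint subsets of ℝ². -/
def PathDisj (P Q : GridPath) : Prop :=
  (P.image \ {P.start, P.fin}) ∩ (Q.image \ {Q.start, Q.fin}) = ∅

/-- The class `SL_j` of paths in scale `K^j` (for `1 ≤ j ≤ m-1`):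
`K^j ≤ ‖P‖ ≤ (1 + 1/K) K^j` and `P ⊆ B(x_P, ‖P‖)`. -/
def SL (K j : ℕ) : Set GridPath :=
  {P | (K : ℝ) ^ j ≤ P.norm ∧ P.norm ≤ (1 + 1 / (K : ℝ)) * (K : ℝ) ^ j ∧
    P.image ⊆ cball P.start P.norm}

/-- The closed box of `BD_r` indexed by `(i₁, i₂) ∈ ℤ²`:
`[i₁ r - 1/2, (i₁+1) r - 1/2] × [i₂ r - 1/2, (i₂+1) r - 1/2]`. -/
def BDbox (r : ℝ) (i : Z2) : Set (ℝ × ℝ) :=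
  {p | (i.1 : ℝ) * r - 1 / 2 ≤ p.1 ∧ p.1 ≤ ((i.1 : ℝ) + 1) * r - 1 / 2 ∧
       (i.2 : ℝ) * r - 1 / 2 ≤ p.2 ∧ p.2 ≤ ((i.2 : ℝ) + 1) * r - 1 / 2}

/-- The ellipse `E(P) = {z : ‖x_P - z‖ + ‖y_P - z‖ ≤ (1 + 2/K²) ‖P‖}`. -/
noncomputable def ellipse (K : ℕ) (P : GridPath) : Set (ℝ × ℝ) :=
  {z | e2 P.start z + e2 P.fin z ≤ (1 + 2 / (K : ℝ) ^ 2) * P.norm}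

/-- A path `P ∈ SL_{j+1}` is tame if `P ⊆ Ẽ(P)`, where `Ẽ(P)` is the closed
`4 K^j`-neighborhood of the (compact) ellipse `E(P)`. -/
noncomputable def Tame (K j : ℕ) (P : GridPath) : Prop :=
  ∀ p ∈ P.image, ∃ w ∈ ellipse K P, e2 p w ≤ 4 * (K : ℝ) ^ j

/-! ### The Euclidean distance -/

lemma e2_norm (p q : ℝ × ℝ) : e2 p q = ‖(⟨p.1, p.2⟩ - ⟨q.1, q.2⟩ : ℂ)‖ := by
  rw [e2, Complex.norm_def, Complex.normSq_apply]
  congr 1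
  simp
  ring

lemma e2_nonneg (p q : ℝ × ℝ) : 0 ≤ e2 p q := Real.sqrt_nonneg _

lemma e2_self (p : ℝ × ℝ) : e2 p p = 0 := by simp [e2]

lemma e2_comm (p q : ℝ × ℝ) : e2 p q = e2 q p := by
  rw [e2_norm, e2_norm, norm_sub_rev]

lemma e2_tri (p q r : ℝ × ℝ) : e2 p r ≤ e2 p q + e2 q r := by
  rw [e2_norm, e2_norm, e2_norm]
  exact norm_sub_le_norm_sub_add_norm_sub _ _ _

lemma e2_cont {f : ℝ → ℝ × ℝ} (hf : Continuous f) (c : ℝ × ℝ) :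
    Continuous (fun t => e2 c (f t)) := by
  unfold e2
  fun_prop

/-! ### Continuity of the curve -/

lemma interp_cont (f : ℤ → ℝ) :
    Continuous (fun t : ℝ => f ⌊t⌋ + (t - ⌊t⌋) * (f (⌊t⌋ + 1) - f ⌊t⌋)) := by
  rw [continuous_iff_continuousAt]
  intro t0
  set n := ⌊t0⌋ with hn
  have h1 : (n : ℝ) ≤ t0 := Int.floor_le t0
  have h2 : t0 < n + 1 := Int.lt_floor_add_one t0
  have hc : ContinuousAt (fun t : ℝ => f n + max (t - n) 0 * (f (n + 1) - f n)
      + min (t - n) 0 * (f n - f (n - 1))) t0 := by fun_prop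
  refine hc.congr ?_
  have hmem : Set.Ioo ((n : ℝ) - 1) (n + 1) ∈ nhds t0 := Ioo_mem_nhds (by linarith) h2
  filter_upwards [hmem] with t ht
  by_cases hle : (n : ℝ) ≤ t
  · have : ⌊t⌋ = n := by rw [Int.floor_eq_iff]; exact ⟨hle, ht.2⟩
    rw [this, max_eq_left (by linarith), min_eq_right (by linarith)]
    ring
  · push Not at hle
    have : ⌊t⌋ = n - 1 := by
      rw [Int.floor_eq_iff]; push_cast; exact ⟨ht.1.le, by linarith⟩
    rw [this, max_eq_right (by linarith), min_eq_left (by linarith)]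
    push_cast
    rw [sub_add_cancel]
    ring

lemma GridPath.pt_cont (P : GridPath) : Continuous P.pt := by
  unfold GridPath.pt
  exact (interp_cont (fun n => ((P.v n).1 : ℝ))).prodMk (interp_cont (fun n => ((P.v n).2 : ℝ)))

/-! ### First and last exits -/

lemma first_exit {f : ℝ → ℝ × ℝ} (hf : Continuous f) {s b ℓ : ℝ} (hs : s ≤ b) (hℓ : 0 ≤ ℓ)
    (h : ℓ ≤ e2 (f s) (f b)) :
    ∃ u, s ≤ u ∧ u ≤ b ∧ e2 (f s) (f u) = ℓ ∧ ∀ t ∈ Set.Icc s u, e2 (f s) (f t) ≤ ℓ := by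
  have hc := e2_cont hf (f s)
  have hcomp : IsCompact (Set.Icc s b ∩ {t | ℓ ≤ e2 (f s) (f t)}) :=
    isCompact_Icc.inter_right (isClosed_le continuous_const hc)
  obtain ⟨u, ⟨⟨hu1, hu2⟩, hu3⟩, hmin⟩ := hcomp.exists_isLeast ⟨b, ⟨hs, le_rfl⟩, h⟩
  have hiv := intermediate_value_Icc hu1 hc.continuousOn
  obtain ⟨t, ht, hte⟩ := hiv (show ℓ ∈ Set.Icc _ _ from ⟨by simpa [e2_self] using hℓ, hu3⟩)
  have hut : u ≤ t := hmin ⟨⟨ht.1, ht.2.trans hu2⟩, (hte.symm : ℓ = _).le⟩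
  have htu : t = u := le_antisymm ht.2 hut
  subst htu
  refine ⟨t, hu1, hu2, hte, ?_⟩
  intro t' ht'
  by_contra hcon
  push Not at hcon
  have : t ≤ t' := hmin ⟨⟨ht'.1, ht'.2.trans hu2⟩, hcon.le⟩
  have : t' = t := le_antisymm ht'.2 this
  subst this
  exact absurd hte hcon.ne'

lemma last_exit {f : ℝ → ℝ × ℝ} (hf : Continuous f) {s b R : ℝ} (c : ℝ × ℝ) (hs : s ≤ b)
    (h0 : e2 c (f s) ≤ R) (h : R ≤ e2 c (f b)) :
    ∃ u, s ≤ u ∧ u ≤ b ∧ e2 c (f u) = R ∧ ∀ t, u < t → t ≤ b → R < e2 c (f t) := by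
  have hc := e2_cont hf c
  have hcomp : IsCompact (Set.Icc s b ∩ {t | e2 c (f t) ≤ R}) :=
    isCompact_Icc.inter_right (isClosed_le hc continuous_const)
  obtain ⟨u, ⟨⟨hu1, hu2⟩, hu3⟩, hmax⟩ := hcomp.exists_isGreatest ⟨s, ⟨le_rfl, hs⟩, h0⟩
  have hiv := intermediate_value_Icc hu2 hc.continuousOn
  obtain ⟨t, ht, hte⟩ := hiv (show R ∈ Set.Icc _ _ from ⟨hu3, h⟩)
  have hut : t ≤ u := hmax ⟨⟨hu1.trans ht.1, ht.2⟩, (hte : _ = R).le⟩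
  have htu : t = u := le_antisymm hut ht.1
  subst htu
  refine ⟨t, hu1, hu2, hte, ?_⟩
  intro t' ht' ht'b
  by_contra hcon
  push Not at hcon
  have : t' ≤ t := hmax ⟨⟨by linarith, ht'b⟩, hcon⟩
  linarith

/-! ### Concentric pieces -/

/-- Pieces `h < n` of the curve `f`, after time `s0`, each crossing the annulus
`hℓ ≤ ‖· - f s0‖ ≤ (h+1)ℓ`. -/
structure Pieces (f : ℝ → ℝ × ℝ) (s0 b ℓ : ℝ) (n : ℕ) (s u : ℕ → ℝ) : Prop where
  start_ge : ∀ h < n, s0 ≤ s h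
  le : ∀ h < n, s h ≤ u h
  le_b : ∀ h < n, u h ≤ b
  start_eq : ∀ h < n, e2 (f s0) (f (s h)) = h * ℓ
  after : ∀ h < n, ∀ t, s h < t → t ≤ b → h * ℓ < e2 (f s0) (f t)
  norm_eq : ∀ h < n, e2 (f (s h)) (f (u h)) = ℓ
  inball : ∀ h < n, ∀ t ∈ Set.Icc (s h) (u h), e2 (f (s h)) (f t) ≤ ℓ

lemma exists_pieces {f : ℝ → ℝ × ℝ} (hf : Continuous f) {s0 b ℓ : ℝ} (hs : s0 ≤ b) (hℓ : 0 < ℓ)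
    (n : ℕ) (hn : n * ℓ ≤ e2 (f s0) (f b)) : ∃ s u, Pieces f s0 b ℓ n s u := by
  have key : ∀ h : ℕ, ∃ s u : ℝ, h < n → s0 ≤ s ∧ s ≤ u ∧ u ≤ b ∧ e2 (f s0) (f s) = h * ℓ ∧
      (∀ t, s < t → t ≤ b → h * ℓ < e2 (f s0) (f t)) ∧ e2 (f s) (f u) = ℓ ∧
      ∀ t ∈ Set.Icc s u, e2 (f s) (f t) ≤ ℓ := by
    intro h
    by_cases hh : h < n
    · have h1 : ((h : ℝ) + 1) * ℓ ≤ e2 (f s0) (f b) := by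
        refine le_trans ?_ hn
        have : (h : ℝ) + 1 ≤ n := by exact_mod_cast hh
        gcongr
      have h0 : 0 ≤ (h : ℝ) * ℓ := by positivity
      obtain ⟨s, hs1, hs2, hs3, hs4⟩ := last_exit hf (R := h * ℓ) (f s0) hs
        (by rw [e2_self]; exact h0) (by linarith)
      have h2 := e2_tri (f s0) (f s) (f b)
      obtain ⟨u, hu1, hu2, hu3, hu4⟩ := first_exit hf (ℓ := ℓ) hs2 hℓ.le (by linarith)
      exact ⟨s, u, fun _ => ⟨hs1, hu1, hu2, hs3, hs4, hu3, hu4⟩⟩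
    · exact ⟨0, 0, fun h' => absurd h' hh⟩
  choose s u hk using key
  exact ⟨s, u, fun h hh => (hk h hh).1, fun h hh => (hk h hh).2.1, fun h hh => (hk h hh).2.2.1,
    fun h hh => (hk h hh).2.2.2.1, fun h hh => (hk h hh).2.2.2.2.1,
    fun h hh => (hk h hh).2.2.2.2.2.1, fun h hh => (hk h hh).2.2.2.2.2.2⟩

namespace Pieces

variable {f : ℝ → ℝ × ℝ} {s0 b ℓ : ℝ} {n : ℕ} {s u : ℕ → ℝ}

lemma upper (hP : Pieces f s0 b ℓ n s u) {h : ℕ} (hh : h < n) {t : ℝ}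
    (ht : t ∈ Set.Icc (s h) (u h)) : e2 (f s0) (f t) ≤ (h + 1) * ℓ := by
  have h1 := e2_tri (f s0) (f (s h)) (f t)
  have h2 := hP.start_eq h hh
  have h3 := hP.inball h hh t ht
  linarith

lemma lower (hP : Pieces f s0 b ℓ n s u) {h : ℕ} (hh : h < n) {t : ℝ}
    (ht : t ∈ Set.Icc (s h) (u h)) : h * ℓ ≤ e2 (f s0) (f t) := by
  rcases ht.1.eq_or_lt with h1 | h1
  · rw [← h1, hP.start_eq h hh]
  · exact (hP.after h hh t h1 (ht.2.trans (hP.le_b h hh))).le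

lemma disj_lt (hP : Pieces f s0 b ℓ n s u) (hℓ : 0 < ℓ) {h h' : ℕ} (hlt : h < h') (hh : h' < n)
    {t t' : ℝ} (ht : t ∈ Set.Icc (s h) (u h)) (ht' : t' ∈ Set.Icc (s h') (u h'))
    (he : f t = f t') : f t' = f (s h') := by
  rcases ht'.1.eq_or_lt with h1 | h1
  · rw [h1]
  · exfalso
    have h2 := hP.after h' hh t' h1 (ht'.2.trans (hP.le_b h' hh))
    have h3 := hP.upper (hlt.trans hh) ht
    have h4 : ((h : ℝ) + 1) * ℓ ≤ h' * ℓ := by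
      have : (h : ℝ) + 1 ≤ h' := by exact_mod_cast hlt
      gcongr
    rw [he] at h3
    linarith

lemma disj (hP : Pieces f s0 b ℓ n s u) (hℓ : 0 < ℓ) {h h' : ℕ} (hne : h ≠ h') (hh : h < n)
    (hh' : h' < n) {t t' : ℝ} (ht : t ∈ Set.Icc (s h) (u h)) (ht' : t' ∈ Set.Icc (s h') (u h'))
    (he : f t = f t') : f t = f (s h) ∨ f t' = f (s h') := by
  rcases lt_or_gt_of_ne hne with h1 | h1
  · exact Or.inr (hP.disj_lt hℓ h1 hh' ht ht' he)
  · exact Or.inl (hP.disj_lt hℓ h1 hh ht' ht he.symm)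

lemma close (hP : Pieces f s0 b ℓ n s u) (hℓ : 0 < ℓ) {h h' : ℕ} (hh : h < n)
    (hh' : h' < n) {t t' : ℝ} (ht : t ∈ Set.Icc (s h) (u h)) (ht' : t' ∈ Set.Icc (s h') (u h'))
    (he : e2 (f t) (f t') ≤ 2 * ℓ) : h' ≤ h + 3 := by
  have h1 := hP.upper hh ht
  have h2 := hP.lower hh' ht'
  have h3 := e2_tri (f s0) (f t) (f t')
  have h4 : (h' : ℝ) * ℓ ≤ (h + 3 : ℝ) * ℓ := by linarith
  have h5 := le_of_mul_le_mul_right h4 hℓ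
  exact_mod_cast h5

lemma mod_inj (hP : Pieces f s0 b ℓ n s u) (hℓ : 0 < ℓ) {h h' : ℕ} (hh : h < n)
    (hh' : h' < n) {t t' : ℝ} (ht : t ∈ Set.Icc (s h) (u h)) (ht' : t' ∈ Set.Icc (s h') (u h'))
    (he : e2 (f t) (f t') ≤ 2 * ℓ) (hm : h % 4 = h' % 4) : h = h' := by
  have h1 := hP.close hℓ hh hh' ht ht' he
  have h2 := hP.close hℓ hh' hh ht' ht (by rw [e2_comm]; exact he)
  omega

end Pieces

lemma box_diam {r : ℝ} (hr : 0 ≤ r) {idx : Z2} {p q : ℝ × ℝ} (hp : p ∈ BDbox r idx)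
    (hq : q ∈ BDbox r idx) : e2 p q ≤ 2 * r := by
  obtain ⟨a1, a2, a3, a4⟩ := hp
  obtain ⟨b1, b2, b3, b4⟩ := hq
  unfold e2
  apply Real.sqrt_le_iff.2
  refine ⟨by positivity, ?_⟩
  have h1 : (p.1 - q.1) ^ 2 ≤ r ^ 2 := sq_le_sq' (by linarith) (by linarith)
  have h2 : (p.2 - q.2) ^ 2 ≤ r ^ 2 := sq_le_sq' (by linarith) (by linarith)
  nlinarith [sq_nonneg r]

/-! ### Assembling the subpaths -/

/-- Restriction of a path to a smaller time interval. -/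
def GridPath.restrict (P : GridPath) (s u : ℝ) (h0 : P.a ≤ s) (h1 : s ≤ u) (h2 : u ≤ P.b) :
    GridPath where
  a := s
  b := u
  hab := h1
  v := P.v
  adj := fun n hn hn' => P.adj n (lt_of_le_of_lt h0 hn) (lt_of_lt_of_le hn' h2)

lemma finish {K j : ℕ} {P : GridPath} {ℓ : ℝ} (hℓ1 : (K : ℝ) ^ j ≤ ℓ)
    (hℓ2 : ℓ ≤ (1 + 1 / (K : ℝ)) * (K : ℝ) ^ j) {ι : Type} [Fintype ι]
    (hpos : 0 < Fintype.card ι) (hK : K ≤ Fintype.card ι)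
    (hb : P.norm / (Fintype.card ι) ≤ ℓ)
    (hb' : ¬ Tame K j P → (1 + 1 / (K : ℝ) ^ 2) * P.norm / (Fintype.card ι) ≤ ℓ)
    (s u : ι → ℝ) (h0 : ∀ i, P.a ≤ s i) (h1 : ∀ i, s i ≤ u i) (h2 : ∀ i, u i ≤ P.b)
    (hnorm : ∀ i, e2 (P.pt (s i)) (P.pt (u i)) = ℓ)
    (hball : ∀ i, ∀ t ∈ Set.Icc (s i) (u i), e2 (P.pt (s i)) (P.pt t) ≤ ℓ)
    (hdisj : ∀ i i', i ≠ i' → ∀ t ∈ Set.Icc (s i) (u i), ∀ t' ∈ Set.Icc (s i') (u i'),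
      P.pt t = P.pt t' → P.pt t = P.pt (s i) ∨ P.pt t' = P.pt (s i'))
    (g : ι → Fin 12)
    (hg : ∀ i i', ∀ t ∈ Set.Icc (s i) (u i), ∀ t' ∈ Set.Icc (s i') (u i'),
      e2 (P.pt t) (P.pt t') ≤ 2 * (K : ℝ) ^ j → g i = g i' → i = i') :
    ∃ ℓ : ℝ, (K : ℝ) ^ j ≤ ℓ ∧ ℓ ≤ (1 + 1 / (K : ℝ)) * (K : ℝ) ^ j ∧
      ∃ d : ℕ, 0 < d ∧
        ∃ Q : Fin d → GridPath,
          (∀ i, SubPath (Q i) P ∧ Q i ∈ SL K j) ∧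
          (∀ i i', i ≠ i' → PathDisj (Q i) (Q i')) ∧
          K ≤ d ∧
          P.norm / d ≤ ℓ ∧
          (¬ Tame K j P → (1 + 1 / (K : ℝ) ^ 2) * P.norm / d ≤ ℓ) ∧
          (∀ idx : Z2,
            Nat.card {i : Fin d //
              ((Q i).image ∩ BDbox ((K : ℝ) ^ j) idx).Nonempty} ≤ 12) ∧
          (∀ i, (Q i).norm = ℓ ∧ (Q i).image ⊆ cball (Q i).start ℓ) := by
  let e := (Fintype.equivFin ι).symm
  let R : ι → GridPath := fun i => P.restrict (s i) (u i) (h0 i) (h1 i) (h2 i)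
  have hn : ∀ i, (R i).norm = ℓ := hnorm
  have hi : ∀ i, (R i).image ⊆ cball (R i).start ℓ := by
    rintro i _ ⟨t, ht, rfl⟩
    exact hball i t ht
  refine ⟨ℓ, hℓ1, hℓ2, Fintype.card ι, hpos, fun i => R (e i), ?_, ?_, hK, hb, hb', ?_, ?_⟩
  · intro i
    refine ⟨⟨h0 _, h2 _, fun t _ => rfl⟩, ?_, ?_, ?_⟩
    · rw [hn]; exact hℓ1
    · rw [hn]; exact hℓ2
    · rw [hn]; exact hi _
  · intro i i' hne
    have hne' : e i ≠ e i' := fun h => hne (e.injective h)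
    unfold PathDisj
    rw [Set.eq_empty_iff_forall_notMem]
    rintro p ⟨⟨⟨t, ht, rfl⟩, hp⟩, ⟨⟨t', ht', he⟩, hp'⟩⟩
    rcases hdisj _ _ hne' t ht t' ht' he.symm with h | h
    · exact hp (Or.inl h)
    · exact hp' (Or.inl (he.symm.trans h))
  · intro idx
    have hinj : Function.Injective
        (fun i : {i : Fin (Fintype.card ι) //
          ((R (e i)).image ∩ BDbox ((K : ℝ) ^ j) idx).Nonempty} => g (e i.1)) := by
      rintro ⟨i, ⟨p, ⟨t, ht, rfl⟩, hp⟩⟩ ⟨i', ⟨p', ⟨t', ht', rfl⟩, hp'⟩⟩ heq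
      have := hg (e i) (e i') t ht t' ht' (box_diam (by positivity) hp hp') heq
      exact Subtype.ext (e.injective this)
    have := Nat.card_le_card_of_injective _ hinj
    simpa using this
  · intro i
    exact ⟨hn _, hi _⟩

/-- The colour of a piece of the first group. -/
def col (h : ℕ) : Fin 12 := ⟨h % 4, by omega⟩

/-- The colour of a piece of the second group. -/
def col' (h : ℕ) : Fin 12 := ⟨4 + h % 4, by omega⟩

/-- **Proposition 3.1 (extraction of subpaths).** For all sufficiently large
`K = 2^k`, every `1 ≤ j ≤ m-2` and every `P ∈ SL_{j+1}` admit
`ℓ ∈ [K^j, (1+1/K) K^j]`, a positive integer `d`, and pairwise disjoint subpaths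
`P⁽¹⁾, …, P⁽ᵈ⁾ ∈ SL_j` of `P` such that (a) `d ≥ K`; (b) `ℓ ≥ ‖P‖/d`, and
`ℓ ≥ (1+1/K²) ‖P‖/d` if `P` is untame; (c) every box of `BD_{K^j}` is visited by
at most `12` of the subpaths; (d) `‖P⁽ⁱ⁾‖ = ℓ` and `P⁽ⁱ⁾ ⊆ B(x_{P⁽ⁱ⁾}, ℓ)`. -/
theorem extract_subpaths :
    ∃ K₀ : ℕ, ∀ k K : ℕ, K = 2 ^ k → K₀ ≤ K →
      ∀ m N : ℕ, K ^ m ≤ N → N < K ^ (m + 1) →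
        ∀ j : ℕ, 1 ≤ j → j + 2 ≤ m →
          ∀ P : GridPath, P ∈ SL K (j + 1) →
            ∃ ℓ : ℝ, (K : ℝ) ^ j ≤ ℓ ∧ ℓ ≤ (1 + 1 / (K : ℝ)) * (K : ℝ) ^ j ∧
              ∃ d : ℕ, 0 < d ∧
                ∃ Q : Fin d → GridPath,
                  (∀ i, SubPath (Q i) P ∧ Q i ∈ SL K j) ∧
                  (∀ i i', i ≠ i' → PathDisj (Q i) (Q i')) ∧
                  K ≤ d ∧
                  P.norm / d ≤ ℓ ∧
                  (¬ Tame K j P → (1 + 1 / (K : ℝ) ^ 2) * P.norm / d ≤ ℓ) ∧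
                  (∀ idx : Z2,
                    Nat.card {i : Fin d //
                      ((Q i).image ∩ BDbox ((K : ℝ) ^ j) idx).Nonempty} ≤ 12) ∧
                  (∀ i, (Q i).norm = ℓ ∧ (Q i).image ⊆ cball (Q i).start ℓ) := by
  refine ⟨1, ?_⟩
  intro k K _ hK0 m N _ _ j _ _ P hP
  obtain ⟨hL1, hL2, -⟩ := hP
  have hf := P.pt_cont
  have hK1 : (1 : ℝ) ≤ K := by exact_mod_cast hK0
  have hKpos : (0 : ℝ) < K := by linarith
  have hinv : 1 / (K : ℝ) ≤ 1 := by rw [div_le_one hKpos]; exact hK1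
  set r : ℝ := (K : ℝ) ^ j with hr
  have hrpos : 0 < r := by positivity
  rw [pow_succ, ← hr] at hL1 hL2
  have hL2' : P.norm ≤ (K + 1) * r := by
    have : (1 + 1 / (K : ℝ)) * (r * K) = (K + 1) * r := by field_simp
    linarith
  have hLpos : 0 < P.norm := lt_of_lt_of_le (by positivity) hL1
  have hLdef : P.norm = e2 (P.pt P.a) (P.pt P.b) := rfl
  by_cases hT : Tame K j P
  · -- tame case
    set ℓ := P.norm / K with hℓ
    have hℓK : K * ℓ = P.norm := by rw [hℓ]; field_simp
    have hℓ1 : r ≤ ℓ := by rw [hℓ, le_div_iff₀ hKpos]; exact hL1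
    have hℓ2 : ℓ ≤ (1 + 1 / (K : ℝ)) * r := by
      rw [hℓ, div_le_iff₀ hKpos]; linarith
    have hℓpos : 0 < ℓ := by linarith
    obtain ⟨s, u, hp⟩ := exists_pieces hf P.hab hℓpos K (by rw [← hLdef, hℓK])
    refine finish (ι := Fin K) hℓ1 hℓ2 (by simp; omega) (by simp) (by simp [hℓ])
      (fun h => absurd hT h) (fun i => s i) (fun i => u i)
      (fun i => hp.start_ge i i.2) (fun i => hp.le i i.2) (fun i => hp.le_b i i.2)
      (fun i => hp.norm_eq i i.2) (fun i => hp.inball i i.2) ?_ (fun i => col i) ?_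
    · intro i i' hne t ht t' ht' he
      exact hp.disj hℓpos (fun h => hne (Fin.ext h)) i.2 i'.2 ht ht' he
    · intro i i' t ht t' ht' he hm
      exact Fin.ext (hp.mod_inj hℓpos i.2 i'.2 ht ht' (by linarith) (congrArg Fin.val hm))
  · -- untame case
    set κ : ℝ := 1 + 1 / (K : ℝ) ^ 2 with hκ
    have hsq1 : 1 / (K : ℝ) ^ 2 ≤ 1 / K := by
      apply one_div_le_one_div_of_le hKpos
      nlinarith
    have hsq0 : 0 < 1 / (K : ℝ) ^ 2 := by positivity
    have hκ1 : 1 < κ := by linarith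
    have hκ2 : κ ≤ 1 + 1 / K := by linarith
    obtain ⟨D, hDK, hDK', hD1, hD2⟩ : ∃ D : ℕ, K ≤ D ∧ D ≤ K + 1 ∧ r ≤ κ * P.norm / D ∧
        κ * P.norm / D ≤ (1 + 1 / (K : ℝ)) * r := by
      by_cases hc : κ * P.norm / K ≤ (1 + 1 / (K : ℝ)) * r
      · refine ⟨K, le_rfl, by omega, ?_, hc⟩
        rw [le_div_iff₀ hKpos]
        nlinarith
      · push Not at hc
        refine ⟨K + 1, by omega, le_rfl, ?_, ?_⟩
        · rw [lt_div_iff₀ hKpos] at hc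
          have : (1 + 1 / (K : ℝ)) * r * K = (K + 1) * r := by field_simp
          push_cast
          rw [le_div_iff₀ (by linarith)]
          linarith
        · push_cast
          rw [div_le_iff₀ (by linarith)]
          have h1 : κ * P.norm ≤ (1 + 1 / K) * ((K + 1) * r) := by gcongr
          linarith
    set ℓ := κ * P.norm / D with hℓ
    have hDge : (K : ℝ) ≤ D := by exact_mod_cast hDK
    have hDle : (D : ℝ) ≤ K + 1 := by exact_mod_cast hDK'
    have hDpos : (0 : ℝ) < D := by linarith
    have hℓpos : 0 < ℓ := by linarith
    have hℓ2r : ℓ ≤ 2 * r := by nlinarith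
    have hDℓ : D * ℓ = κ * P.norm := by rw [hℓ]; field_simp
    have hbd : ∀ d : ℕ, D ≤ d → κ * P.norm / d ≤ ℓ := by
      intro d hd
      have : (D : ℝ) ≤ d := by exact_mod_cast hd
      rw [hℓ]
      gcongr
    have hbd' : ∀ d : ℕ, D ≤ d → P.norm / d ≤ ℓ := by
      intro d hd
      refine le_trans ?_ (hbd d hd)
      gcongr
      nlinarith
    have hDm : ((D - 1 : ℕ) : ℝ) = D - 1 := by
      rw [Nat.cast_sub (by omega)]; simp
    have hD1ℓ : ((D - 1 : ℕ) : ℝ) * ℓ ≤ e2 (P.pt P.a) (P.pt P.b) := by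
      rw [hDm, ← hLdef]
      have h1 : κ * P.norm - ℓ ≤ P.norm := by
        have h2 : (1 / (K : ℝ) ^ 2) * P.norm ≤ ℓ := by
          rw [hℓ, le_div_iff₀ hDpos]
          have h3 : 1 / (K : ℝ) ^ 2 * (K + 1) ≤ κ := by
            rw [hκ]
            have : 1 / (K : ℝ) ^ 2 * K = 1 / K := by field_simp
            nlinarith
          have h4 : 1 / (K : ℝ) ^ 2 * D ≤ κ := le_trans (by gcongr) h3
          nlinarith
        rw [hκ]; linarith
      linarith
    obtain ⟨s, u, hp⟩ := exists_pieces hf P.hab hℓpos (D - 1) hD1ℓ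
    have hT' := hT
    unfold Tame at hT'
    push Not at hT'
    obtain ⟨_, ⟨tp, htp, rfl⟩, hfar⟩ := hT'
    rw [← hr] at hfar
    by_cases hnear : ∀ h < D - 1, 4 * r < e2 (P.pt tp) (P.pt (s h))
    · -- one additional piece started at the far point
      have hyE : P.pt P.b ∈ ellipse K P := by
        change e2 (P.pt P.a) (P.pt P.b) + e2 (P.pt P.b) (P.pt P.b) ≤ _
        rw [e2_self, ← hLdef]
        have : 0 ≤ 2 / (K : ℝ) ^ 2 := by positivity
        nlinarith
      have hy := hfar _ hyE
      obtain ⟨v, hv1, hv2, hv3, hv4⟩ := first_exit hf (ℓ := ℓ) htp.2 hℓpos.le (by linarith)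
      have hcard : Fintype.card (Option (Fin (D - 1))) = D := by
        simp; omega
      have hx : ∀ h < D - 1, ∀ t ∈ Set.Icc (s h) (u h), ∀ t' ∈ Set.Icc tp v,
          P.pt t ≠ P.pt t' := by
        intro h hh t ht t' ht' he
        have h1 := hp.inball h hh t ht
        have h2 := hv4 t' ht'
        have h3 := e2_tri (P.pt tp) (P.pt t') (P.pt (s h))
        rw [← he, e2_comm (P.pt t)] at h3
        rw [← he] at h2
        have := hnear h hh
        linarith
      refine finish (ι := Option (Fin (D - 1))) hD1 hD2 (by rw [hcard]; omega)
        (by rw [hcard]; exact hDK) (by rw [hcard]; exact hbd' D le_rfl)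
        (fun _ => by rw [hcard])
        (fun i => i.elim tp (fun h => s h)) (fun i => i.elim v (fun h => u h))
        ?_ ?_ ?_ ?_ ?_ ?_ (fun i => i.elim 11 (fun h => col h)) ?_
      · rintro (_ | i)
        · exact htp.1
        · exact hp.start_ge i i.2
      · rintro (_ | i)
        · exact hv1
        · exact hp.le i i.2
      · rintro (_ | i)
        · exact hv2
        · exact hp.le_b i i.2
      · rintro (_ | i)
        · exact hv3
        · exact hp.norm_eq i i.2
      · rintro (_ | i)
        · exact hv4
        · exact hp.inball i i.2
      · rintro (_ | i) (_ | i') hne t ht t' ht' he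
        · exact absurd rfl hne
        · exact absurd he.symm (hx i' i'.2 t' ht' t ht)
        · exact absurd he (hx i i.2 t ht t' ht')
        · exact hp.disj hℓpos (fun h => hne (congrArg some (Fin.ext h))) i.2 i'.2 ht ht' he
      · rintro (_ | i) (_ | i') t ht t' ht' he hm
        · rfl
        · have := congrArg Fin.val hm
          simp [col] at this
          omega
        · have := congrArg Fin.val hm
          simp [col] at this
          omega
        · exact congrArg some (Fin.ext (hp.mod_inj hℓpos i.2 i'.2 ht ht' (by linarith)
            (congrArg Fin.val hm)))
    · -- two groups
      push Not at hnear
      obtain ⟨H, hH, hHn⟩ := hnear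
      have hxE : P.pt (s H) ∉ ellipse K P := fun h => absurd (hfar _ h) (by linarith)
      have hxE' : (1 + 2 / (K : ℝ) ^ 2) * P.norm <
          e2 (P.pt P.a) (P.pt (s H)) + e2 (P.pt P.b) (P.pt (s H)) := not_le.1 hxE
      rw [hp.start_eq H hH, e2_comm] at hxE'
      have hsH : P.a ≤ s H := hp.start_ge H hH
      have hsHb : s H ≤ P.b := (hp.le H hH).trans (hp.le_b H hH)
      set n' := ⌊e2 (P.pt (s H)) (P.pt P.b) / ℓ⌋₊ with hn'
      have hn1 : n' * ℓ ≤ e2 (P.pt (s H)) (P.pt P.b) := by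
        rw [← le_div_iff₀ hℓpos]
        exact Nat.floor_le (div_nonneg (e2_nonneg _ _) hℓpos.le)
      have hn2 : e2 (P.pt (s H)) (P.pt P.b) < (n' + 1) * ℓ := by
        rw [← div_lt_iff₀ hℓpos]
        exact Nat.lt_floor_add_one _
      obtain ⟨s', u', hp'⟩ := exists_pieces hf hsHb hℓpos n' hn1
      have hcount : D ≤ H + n' := by
        have h1 : (D : ℝ) * ℓ < (H + n' + 1) * ℓ := by
          have h2 : κ * P.norm ≤ (1 + 2 / (K : ℝ) ^ 2) * P.norm := by
            rw [hκ]
            gcongr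
            norm_num
          rw [hDℓ]
          linarith
        have h3 := lt_of_mul_lt_mul_right h1 hℓpos.le
        have h4 : D < H + n' + 1 := by exact_mod_cast h3
        omega
      have hcard : Fintype.card (Fin H ⊕ Fin n') = H + n' := by simp
      have hx : ∀ h < H, ∀ h' < n', ∀ t ∈ Set.Icc (s h) (u h), ∀ t' ∈ Set.Icc (s' h') (u' h'),
          P.pt t = P.pt t' → P.pt t' = P.pt (s' h') := by
        intro h hh h' hh' t ht t' ht' he
        rcases ht'.1.eq_or_lt with h1 | h1
        · rw [h1]
        · exfalso
          have h2 := hp.after H hH t' (lt_of_le_of_lt (hp'.start_ge h' hh') h1)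
            (ht'.2.trans (hp'.le_b h' hh'))
          have h3 := hp.upper (hh.trans hH) ht
          have h4 : ((h : ℝ) + 1) * ℓ ≤ H * ℓ := by
            have : (h : ℝ) + 1 ≤ H := by exact_mod_cast hh
            gcongr
          rw [he] at h3
          linarith
      have hlt : ∀ i : Fin H, (i : ℕ) < D - 1 := fun i => i.2.trans hH
      refine finish (ι := Fin H ⊕ Fin n') hD1 hD2 (by rw [hcard]; omega)
        (by rw [hcard]; omega) (by rw [hcard]; exact hbd' _ hcount)
        (fun _ => by rw [hcard]; exact hbd _ hcount)
        (fun i => i.elim (fun h : Fin H => s h) (fun h : Fin n' => s' h))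
        (fun i => i.elim (fun h : Fin H => u h) (fun h : Fin n' => u' h))
        ?_ ?_ ?_ ?_ ?_ ?_ (fun i => i.elim (fun h : Fin H => col h) (fun h : Fin n' => col' h)) ?_
      · rintro (i | i)
        · exact hp.start_ge i (hlt i)
        · exact hsH.trans (hp'.start_ge i i.2)
      · rintro (i | i)
        · exact hp.le i (hlt i)
        · exact hp'.le i i.2
      · rintro (i | i)
        · exact hp.le_b i (hlt i)
        · exact hp'.le_b i i.2
      · rintro (i | i)
        · exact hp.norm_eq i (hlt i)
        · exact hp'.norm_eq i i.2
      · rintro (i | i)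
        · exact hp.inball i (hlt i)
        · exact hp'.inball i i.2
      · rintro (i | i) (i' | i') hne t ht t' ht' he
        · exact hp.disj hℓpos (fun h => hne (congrArg Sum.inl (Fin.ext h))) (hlt i) (hlt i')
            ht ht' he
        · exact Or.inr (hx i i.2 i' i'.2 t ht t' ht' he)
        · exact Or.inl (hx i' i'.2 i i.2 t' ht' t ht he.symm)
        · exact hp'.disj hℓpos (fun h => hne (congrArg Sum.inr (Fin.ext h))) i.2 i'.2 ht ht' he
      · rintro (i | i) (i' | i') t ht t' ht' he hm
        · exact congrArg Sum.inl (Fin.ext (hp.mod_inj hℓpos (hlt i) (hlt i') ht ht' (by linarith)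
            (congrArg Fin.val hm)))
        · have := congrArg Fin.val hm
          simp [col, col'] at this
          omega
        · have := congrArg Fin.val hm
          simp [col, col'] at this
          omega
        · have h5 : 4 + (i : ℕ) % 4 = 4 + (i' : ℕ) % 4 := congrArg Fin.val hm
          exact congrArg Sum.inr (Fin.ext (hp'.mod_inj hℓpos i.2 i'.2 ht ht' (by linarith)
            (by omega)))
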